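/- Let S = ℝ² \ {0}. The four closed half-planes {(x,y) : x ≥ 0}, {(x,y) : x ≤ 0}, {(x,y) : y ≥ 0}, {(x,y) : y ≤ 0} have the property that any three of them have a common point belonging to S, but the intersection of all four contains no point of S. Consequently the dense set S = ℝ² \ {0} satisfies h(S) ≥ 4, so the bound 4 in the Helly theorem for dense planar sets is sharp. -/

import Mathlib

def HellyLe {d : ℕ} (S : Set (EuclideanSpace ℝ (Fin d))) (n : ℕ) : Prop :=
  ∀ (m : ℕ) (F : Fin m → Set (EuclideanSpace ℝ (Fin d))),
    (∀ i, Convex ℝ (F i)) →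
    (∀ I : Finset (Fin m), I.card ≤ n → (S ∩ ⋂ i ∈ I, F i).Nonempty) →
    (S ∩ ⋂ i, F i).Nonempty

/-- The punctured plane `S = ℝ² \ {0}`. -/
def S1 : Set (EuclideanSpace ℝ (Fin 2)) := {x | x ≠ 0}

/-- The four closed half-planes `x ≥ 0`, `x ≤ 0`, `y ≥ 0`, `y ≤ 0`. -/
def K1 : Fin 4 → Set (EuclideanSpace ℝ (Fin 2)) :=
  ![{x | 0 ≤ x 0}, {x | x 0 ≤ 0}, {x | 0 ≤ x 1}, {x | x 1 ≤ 0}]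

theorem convex_K1 (i : Fin 4) : Convex ℝ (K1 i) := by
  have hcoord (k : Fin 2) : IsLinearMap ℝ fun x : EuclideanSpace ℝ (Fin 2) => x k :=
    ⟨fun _ _ => rfl, fun _ _ => rfl⟩
  fin_cases i
  · exact convex_halfSpace_ge (hcoord 0) 0
  · exact convex_halfSpace_le (hcoord 0) 0
  · exact convex_halfSpace_ge (hcoord 1) 0
  · exact convex_halfSpace_le (hcoord 1) 0

theorem S1_inter_iInter_compl_singleton_K1_nonempty (i : Fin 4) :
    (S1 ∩ ⋂ j ∈ ({i}ᶜ : Finset (Fin 4)), K1 j).Nonempty := by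
  fin_cases i
  · refine ⟨!₂[-1, 0], fun h => by simpa using congrArg (· 0) h, ?_⟩
    simp [K1, Fin.forall_fin_succ]
  · refine ⟨!₂[1, 0], fun h => by simpa using congrArg (· 0) h, ?_⟩
    simp [K1, Fin.forall_fin_succ]
  · refine ⟨!₂[0, -1], fun h => by simpa using congrArg (· 1) h, ?_⟩
    simp [K1, Fin.forall_fin_succ]
  · refine ⟨!₂[0, 1], fun h => by simpa using congrArg (· 1) h, ?_⟩
    simp [K1, Fin.forall_fin_succ]

theorem S1_inter_iInter_K1_eq_empty : (S1 ∩ ⋂ i, K1 i) = ∅ := by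
  refine Set.eq_empty_of_forall_notMem fun x ⟨hx, hK⟩ => hx ?_
  rw [Set.mem_iInter] at hK
  ext k
  fin_cases k
  · exact le_antisymm (hK 1) (hK 0)
  · exact le_antisymm (hK 3) (hK 2)

theorem not_hellyLe_S1_three : ¬ HellyLe S1 3 := by
  intro h
  refine (h 4 K1 convex_K1 fun I hI => ?_).ne_empty S1_inter_iInter_K1_eq_empty
  obtain ⟨i, hi⟩ : ∃ i, i ∉ I := by
    by_contra! hall
    have hcard : I.card = 4 := by simp [Finset.eq_univ_of_forall hall]
    omega
  refine (S1_inter_iInter_compl_singleton_K1_nonempty i).mono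
    (Set.inter_subset_inter_right _ (Set.biInter_subset_biInter_left fun j hj => ?_))
  simpa using ne_of_mem_of_not_mem hj hi

/-- The four half-planes are convex, any three of them meet `S = ℝ² \ {0}`, but all four
together contain no point of `S`; consequently the dense set `S` satisfies `h(S) ≥ 4`,
i.e. `h(S) ≤ 3` fails. -/
theorem punctured_plane_sharp :
    (∀ i, Convex ℝ (K1 i)) ∧
    (∀ i : Fin 4, (S1 ∩ ⋂ j ∈ ({i}ᶜ : Finset (Fin 4)), K1 j).Nonempty) ∧
    (S1 ∩ ⋂ i, K1 i) = ∅ ∧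
    Dense S1 ∧
    ¬ HellyLe S1 3 := by
  exact ⟨convex_K1, S1_inter_iInter_compl_singleton_K1_nonempty, S1_inter_iInter_K1_eq_empty,
    dense_compl_singleton 0, not_hellyLe_S1_three⟩
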